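/- arXiv:2011.12897 — 3 statements merged into one kernel-verified Lean document; each statement's English description precedes it below -/
import Mathlib

section
/- Let p be a prime number and let A be an abelian group such that every element of A has order a power of p and such that the p-torsion subgroup A[p] = {a ∈ A : p • a = 0} is finite. Then there exist a natural number r and a finite abelian group A₀ such that A is isomorphic (as an abelian group) to the direct sum of r copies of ℚ_p/ℤ_p with A₀. -/
/-- The Prüfer `p`-group `ℚ_p/ℤ_p`: the quotient of the additive group of the `p`-adic
numbers by the additive subgroup given by the `p`-adic integers. -/
noncomputable def PadicQuotient (p : ℕ) [Fact p.Prime] : Type :=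
  ℚ_[p] ⧸ (LinearMap.range (Algebra.linearMap ℤ_[p] ℚ_[p]))

noncomputable instance (p : ℕ) [Fact p.Prime] : AddCommGroup (PadicQuotient p) :=
  inferInstanceAs (AddCommGroup (ℚ_[p] ⧸ (LinearMap.range (Algebra.linearMap ℤ_[p] ℚ_[p]))))

namespace AddMonoidHom

variable {D E : Type*} [AddCommGroup D] [AddCommGroup E] {p : ℕ}

/-- A homomorphism out of a `p`-primary group is injective as soon as its kernel contains no
nonzero element killed by `p`. -/
theorem injective_of_forall_torsion (hD : ∀ d : D, ∃ n : ℕ, p ^ n • d = 0) (f : D →+ E)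
    (hf : ∀ d, p • d = 0 → f d = 0 → d = 0) : Function.Injective f := by
  have key : ∀ (n : ℕ) (d : D), p ^ n • d = 0 → f d = 0 → d = 0 := by
    intro n
    induction n with
    | zero => intro d hd _; simpa using hd
    | succ n ih =>
      intro d hd hfd
      refine hf d (ih (p • d) ?_ ?_) hfd
      · rwa [smul_smul, ← pow_succ]
      · rw [map_nsmul, hfd, smul_zero]
  refine (injective_iff_map_eq_zero f).2 fun d hd ↦ ?_
  obtain ⟨n, hn⟩ := hD d
  exact key n d hn hd

/-- A homomorphism from a `p`-divisible group to a `p`-primary group is surjective as soon as its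
range contains every element killed by `p`. -/
theorem surjective_of_forall_torsion (hD : ∀ d : D, ∃ d', p • d' = d)
    (hE : ∀ e : E, ∃ n : ℕ, p ^ n • e = 0) (f : D →+ E)
    (hf : ∀ e, p • e = 0 → ∃ d, f d = e) : Function.Surjective f := by
  have hdiv : ∀ (n : ℕ) (d : D), ∃ d', p ^ n • d' = d := by
    intro n
    induction n with
    | zero => exact fun d ↦ ⟨d, by simp⟩
    | succ n ih =>
      intro d
      obtain ⟨d₁, rfl⟩ := hD d
      obtain ⟨d₂, rfl⟩ := ih d₁
      exact ⟨d₂, by rw [smul_smul, ← pow_succ']⟩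
  have key : ∀ (n : ℕ) (e : E), p ^ n • e = 0 → ∃ d, f d = e := by
    intro n
    induction n with
    | zero => exact fun e he ↦ ⟨0, by simpa using he.symm⟩
    | succ n ih =>
      intro e he
      obtain ⟨d, hd⟩ := hf (p ^ n • e) (by rwa [smul_smul, ← pow_succ'])
      obtain ⟨d', rfl⟩ := hdiv n d
      obtain ⟨d₁, hd₁⟩ := ih (e - f d') (by rw [smul_sub, ← map_nsmul, hd, sub_self])
      exact ⟨d₁ + d', by rw [map_add, hd₁, sub_add_cancel]⟩
  intro e
  obtain ⟨n, hn⟩ := hE e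
  exact key n e hn

end AddMonoidHom

section Torsion

variable {A : Type*} [AddCommGroup A] {p : ℕ}

theorem finite_setOf_pow_nsmul_eq_zero (hfin : {a : A | p • a = 0}.Finite) (n : ℕ) :
    {a : A | p ^ n • a = 0}.Finite := by
  induction n with
  | zero => simp
  | succ n ih =>
    have : {a : A | p ^ (n + 1) • a = 0} = (fun a ↦ p • a) ⁻¹' {a : A | p ^ n • a = 0} := by
      ext a
      simp [smul_smul, pow_succ]
    rw [this]
    refine ih.preimage' fun b _ ↦ ?_
    rcases ((fun a : A ↦ p • a) ⁻¹' {b}).eq_empty_or_nonempty with h | ⟨c, hc⟩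
    · simp [h]
    · refine (hfin.image (fun a ↦ a + c)).subset fun a ha ↦ ⟨a - c, ?_, by simp⟩
      simp only [Set.mem_preimage, Set.mem_singleton_iff] at ha hc
      simp [smul_sub, ha, hc]

/-- In a `p`-primary group with finite `p`-torsion, some `p ^ N • A` is `p`-divisible. -/
theorem exists_pow_nsmul_range_divisible (horder : ∀ a : A, ∃ n : ℕ, p ^ n • a = 0)
    (hfin : {a : A | p • a = 0}.Finite) :
    ∃ N : ℕ, ∀ d : (nsmulAddMonoidHom (α := A) (p ^ N)).range, ∃ d', p • d' = d := by
  have := hfin.to_subtype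
  let T : ℕ →o (Set {a : A | p • a = 0})ᵒᵈ :=
    ⟨fun n ↦ OrderDual.toDual {a | ∃ c : A, p ^ n • c = a}, by
      intro m n hmn
      change {a : {a : A | p • a = 0} | ∃ c : A, p ^ n • c = a} ⊆ {a | ∃ c : A, p ^ m • c = a}
      rintro a ⟨c, hc⟩
      exact ⟨p ^ (n - m) • c, by rw [smul_smul, ← pow_add, Nat.add_sub_cancel' hmn, hc]⟩⟩
  obtain ⟨N, hN⟩ := WellFoundedGT.monotone_chain_condition T
  have hstab : ∀ (m : ℕ) (a : A), p • a = 0 → (∃ c, p ^ N • c = a) →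
      ∃ c, p ^ (N + m) • c = a := by
    intro m a ha hc
    have h : (⟨a, ha⟩ : {a : A | p • a = 0}) ∈ OrderDual.ofDual (T N) := hc
    rw [hN (N + m) (Nat.le_add_right _ _)] at h
    exact h
  have key : ∀ (k : ℕ) (c : A), p ^ k • p ^ N • c = 0 → ∃ e, p ^ (N + 1) • e = p ^ N • c := by
    intro k
    induction k with
    | zero => exact fun c hc ↦ ⟨0, by simpa using hc.symm⟩
    | succ k ih =>
      intro c hc
      obtain ⟨e, he⟩ := hstab (k + 1) (p ^ k • p ^ N • c) (by rwa [smul_smul, ← pow_succ'])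
        ⟨p ^ k • c, smul_comm _ _ _⟩
      obtain ⟨e', he'⟩ := ih (c - p • e) (by
        rw [smul_sub, smul_sub, ← he, sub_eq_zero]
        simp only [smul_smul, ← pow_succ, ← pow_add]
        congr 2
        ring)
      refine ⟨e' + e, ?_⟩
      rw [smul_add, he', smul_sub, smul_smul, ← pow_succ, sub_add_cancel]
  refine ⟨N, ?_⟩
  rintro ⟨_, c, rfl⟩
  obtain ⟨k, hk⟩ := horder (p ^ N • c)
  obtain ⟨e, he⟩ := key k c hk
  refine ⟨⟨p ^ N • e, e, rfl⟩, Subtype.ext ?_⟩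
  simpa [smul_smul, ← pow_succ'] using he

end Torsion

namespace PadicQuotient

variable (p : ℕ) [Fact p.Prime]

/-- The quotient map `ℚ_p → ℚ_p/ℤ_p`. -/
noncomputable def mk : ℚ_[p] →+ PadicQuotient p :=
  (Submodule.mkQ (LinearMap.range (Algebra.linearMap ℤ_[p] ℚ_[p]))).toAddMonoidHom

theorem mk_surjective : Function.Surjective (mk p) :=
  Submodule.mkQ_surjective _

variable {p}

theorem mk_eq_zero {q : ℚ_[p]} : mk p q = 0 ↔ ∃ z : ℤ_[p], (z : ℚ_[p]) = q :=
  Submodule.Quotient.mk_eq_zero (LinearMap.range (Algebra.linearMap ℤ_[p] ℚ_[p]))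

variable (p)

noncomputable instance : DivisibleBy (PadicQuotient p) ℤ :=
  (mk_surjective p).divisibleBy (mk p) fun a n ↦ map_zsmul (mk p) n a

theorem exists_pow_nsmul_eq_zero (x : PadicQuotient p) : ∃ n : ℕ, p ^ n • x = 0 := by
  obtain ⟨q, rfl⟩ := mk_surjective p x
  have hp1 : (1 : ℝ) < p := by exact_mod_cast (Fact.out : p.Prime).one_lt
  obtain ⟨n, hn⟩ := pow_unbounded_of_one_lt ‖q‖ hp1
  refine ⟨n, ?_⟩
  rw [← map_nsmul, mk_eq_zero]
  refine ⟨⟨p ^ n • q, ?_⟩, rfl⟩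
  rw [nsmul_eq_mul, norm_mul, Nat.cast_pow, norm_pow, Padic.norm_p, inv_pow,
    inv_mul_le_iff₀ (by positivity), mul_one]
  exact hn.le

/-- The embedding of `ℤ/pℤ` into `ℚ_p/ℤ_p` sending `1` to the class of `1/p`. -/
noncomputable def ofZMod : ZMod p →+ PadicQuotient p :=
  ZMod.lift p ⟨(mk p).comp ((AddMonoidHom.mulRight (p : ℚ_[p])⁻¹).comp (Int.castAddHom ℚ_[p])), by
    have hp0 : (p : ℚ_[p]) ≠ 0 := by exact_mod_cast (Fact.out : p.Prime).ne_zero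
    exact mk_eq_zero.2 ⟨1, by simp [hp0]⟩⟩

theorem ofZMod_intCast (k : ℤ) : ofZMod p k = mk p (k * (p : ℚ_[p])⁻¹) :=
  ZMod.lift_coe _ _ _

theorem ofZMod_injective : Function.Injective (ofZMod p) := by
  have hp0 : (p : ℚ_[p]) ≠ 0 := by exact_mod_cast (Fact.out : p.Prime).ne_zero
  refine (injective_iff_map_eq_zero _).2 fun x hx ↦ ?_
  obtain ⟨k, rfl⟩ := ZMod.intCast_surjective x
  rw [ofZMod_intCast, mk_eq_zero] at hx
  obtain ⟨z, hz⟩ := hx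
  have h : (k : ℤ_[p]) = z * p := by
    apply Subtype.ext
    push_cast
    rw [hz, inv_mul_cancel_right₀ hp0]
  have := congrArg PadicInt.toZMod h
  simpa using this

theorem exists_ofZMod_eq {x : PadicQuotient p} (hx : p • x = 0) : ∃ k, ofZMod p k = x := by
  have hp0 : (p : ℚ_[p]) ≠ 0 := by exact_mod_cast (Fact.out : p.Prime).ne_zero
  obtain ⟨q, rfl⟩ := mk_surjective p x
  rw [← map_nsmul, mk_eq_zero] at hx
  obtain ⟨z, hz⟩ := hx
  have hmem := z.sub_zmodRepr_mem
  rw [PadicInt.maximalIdeal_eq_span_p, Ideal.mem_span_singleton] at hmem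
  obtain ⟨w, hw⟩ := hmem
  refine ⟨(z.zmodRepr : ℤ), ?_⟩
  rw [ofZMod_intCast, ← sub_eq_zero, ← map_sub, mk_eq_zero]
  refine ⟨-w, ?_⟩
  have hw' := congrArg (fun t : ℤ_[p] ↦ (t : ℚ_[p])) hw
  push_cast at hw' ⊢
  rw [hz, nsmul_eq_mul] at hw'
  field_simp
  linear_combination hw'

end PadicQuotient

/-- A finite `𝔽_p`-vector space embeds in a power of `ℚ_p/ℤ_p` as the full subgroup
of elements killed by `p`. -/
theorem exists_embedding_pi_padicQuotient (p : ℕ) [Fact p.Prime] (V : Type*) [AddCommGroup V]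
    [Finite V] [Module (ZMod p) V] :
    ∃ (r : ℕ) (g : V →+ (Fin r → PadicQuotient p)), Function.Injective g ∧
      ∀ y, p • y = 0 → ∃ v, g v = y := by
  have : Module.Finite (ZMod p) V := Module.Finite.of_finite
  let e : V ≃ₗ[ZMod p] (Fin (Module.finrank (ZMod p) V) → ZMod p) :=
    (Module.finBasis (ZMod p) V).equivFun
  let g := ((PadicQuotient.ofZMod p).compLeft (Fin (Module.finrank (ZMod p) V))).comp
    e.toLinearMap.toAddMonoidHom
  refine ⟨_, g, ?_, fun y hy ↦ ?_⟩
  · exact (PadicQuotient.ofZMod_injective p).comp_left.comp e.injective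
  · choose k hk using fun i ↦ PadicQuotient.exists_ofZMod_eq p (congrFun hy i)
    exact ⟨e.symm k, funext fun i ↦ by simp [g, hk]⟩

/-- If `f : A → E` restricts to an isomorphism on a subgroup `D`, then `A` splits as
`E × ker f`. -/
theorem AddMonoidHom.nonempty_addEquiv_prod_ker {A E : Type*} [AddCommGroup A] [AddCommGroup E]
    (f : A →+ E) (D : AddSubgroup A) (hf : Function.Bijective (f.comp D.subtype)) :
    Nonempty (A ≃+ E × f.ker) := by
  let e : D ≃+ E := AddEquiv.ofBijective _ hf
  have he : ∀ y, f (e.symm y) = y := e.apply_symm_apply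
  exact ⟨{
    toFun a := (f a, ⟨a - e.symm (f a), by simp [AddMonoidHom.mem_ker, he]⟩)
    invFun x := e.symm x.1 + x.2
    left_inv a := by simp
    right_inv x := by
      have hx : f x.2 = 0 := x.2.2
      ext <;> simp [he, hx]
    map_add' a b := by
      ext
      · simp
      · simp only [map_add, AddSubgroup.coe_add, Prod.snd_add]
        abel }⟩

/-- Every finite abelian group is isomorphic to one in the lowest universe. -/
theorem exists_addEquiv_type_of_finite (B : Type*) [AddCommGroup B] [Finite B] :
    ∃ (A₀ : Type) (_ : AddCommGroup A₀) (_ : Finite A₀), Nonempty (B ≃+ A₀) := by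
  have : Small.{0} B := Countable.toSmall B
  exact ⟨Shrink.{0} B, inferInstance, inferInstance, ⟨Shrink.addEquiv.symm⟩⟩

/-- a `p`-primary abelian group `A` with finite `p`-torsion subgroup `A[p]`
is isomorphic to `(ℚ_p/ℤ_p)^r × A₀` for some `r : ℕ` and some finite abelian group `A₀`. -/
theorem statement0 (p : ℕ) (hp : p.Prime) (A : Type*) [AddCommGroup A]
    (horder : ∀ a : A, ∃ n : ℕ, p ^ n • a = 0)
    (hfin : {a : A | p • a = 0}.Finite) :
    haveI : Fact p.Prime := ⟨hp⟩
    ∃ (r : ℕ) (A₀ : Type) (_ : AddCommGroup A₀) (_ : Finite A₀),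
      Nonempty (A ≃+ ((Fin r → PadicQuotient p) × A₀)) := by
  have : Fact p.Prime := ⟨hp⟩
  obtain ⟨N, hdiv⟩ := exists_pow_nsmul_range_divisible horder hfin
  set D := (nsmulAddMonoidHom (α := A) (p ^ N)).range
  have hDorder : ∀ d : D, ∃ n : ℕ, p ^ n • d = 0 := fun d ↦
    (horder d).imp fun n hn ↦ Subtype.ext hn
  let V : AddSubgroup D := (nsmulAddMonoidHom (α := D) p).ker
  have hVfin : Finite V := by
    have := hfin.to_subtype
    refine Finite.of_injective
      (fun v : V ↦ (⟨v, congrArg Subtype.val v.2⟩ : {a : A | p • a = 0})) fun v w h ↦ ?_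
    have h' : (v : A) = w := congrArg (fun a : {a : A | p • a = 0} ↦ (a : A)) h
    exact Subtype.ext (Subtype.ext h')
  let _ : Module (ZMod p) V := AddCommGroup.zmodModule fun v ↦ Subtype.ext v.2
  obtain ⟨r, g, hg, hg'⟩ := exists_embedding_pi_padicQuotient p V
  obtain ⟨f, hf⟩ :=
    (Module.Baer.of_divisible (Fin r → PadicQuotient p)).extension_property_addMonoidHom
    (D.subtype.comp V.subtype) (D.subtype_injective.comp V.subtype_injective) g
  have hfg : ∀ v : V, f v = g v := DFunLike.congr_fun hf
  have hinj : Function.Injective (f.comp D.subtype) :=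
    AddMonoidHom.injective_of_forall_torsion hDorder _ fun d hd hfd ↦ by
      have h : g ⟨d, hd⟩ = 0 := (hfg ⟨d, hd⟩).symm.trans hfd
      exact congrArg Subtype.val ((map_eq_zero_iff g hg).1 h)
  have hEorder : ∀ y : Fin r → PadicQuotient p, ∃ n : ℕ, p ^ n • y = 0 := by
    intro y
    choose n hn using fun i ↦ PadicQuotient.exists_pow_nsmul_eq_zero p (y i)
    refine ⟨∑ i, n i, funext fun i ↦ ?_⟩
    obtain ⟨c, hc⟩ := pow_dvd_pow p (Finset.single_le_sum (fun _ _ ↦ Nat.zero_le _)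
      (Finset.mem_univ i) : n i ≤ ∑ i, n i)
    rw [Pi.smul_apply, hc, mul_comm, mul_smul, hn, smul_zero, Pi.zero_apply]
  have hsurj : Function.Surjective (f.comp D.subtype) :=
    AddMonoidHom.surjective_of_forall_torsion hdiv hEorder _ fun y hy ↦ by
      obtain ⟨v, rfl⟩ := hg' y hy
      exact ⟨v, hfg v⟩
  obtain ⟨e⟩ := f.nonempty_addEquiv_prod_ker D ⟨hinj, hsurj⟩
  have hker : Finite f.ker := by
    refine ((finite_setOf_pow_nsmul_eq_zero hfin N).subset fun a ha ↦ ?_).to_subtype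
    have h : (⟨p ^ N • a, a, rfl⟩ : D) = 0 := hinj (by
      have ha' : f a = 0 := ha
      simp [ha'])
    exact congrArg Subtype.val h
  obtain ⟨A₀, _, _, ⟨ε⟩⟩ := exists_addEquiv_type_of_finite f.ker
  exact ⟨r, A₀, _, ‹_›, ⟨e.trans ((AddEquiv.refl _).prodCongr ε)⟩⟩
end

section
/- Let p be a prime number and let A be an abelian group such that every element of A has order a power of p and the p-torsion subgroup A[p] is finite. If f : A → H is a surjective homomorphism of abelian groups and H has finite exponent (there exists a positive integer m with m • h = 0 for all h ∈ H), then H is a finite group. -/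
/-- In an abelian group, if the `a`-torsion and the `b`-torsion are finite, so is the
`a * b`-torsion. -/
theorem finite_setOf_mul_nsmul_eq_zero {A : Type*} [AddCommGroup A] {a b : ℕ}
    (ha : {x : A | a • x = 0}.Finite) (hb : {x : A | b • x = 0}.Finite) :
    {x : A | (a * b) • x = 0}.Finite := by
  have hmaps : Set.MapsTo (fun x : A => b • x) {x : A | (a * b) • x = 0} {x : A | a • x = 0} := by
    intro x hx
    simpa [mul_smul] using hx
  refine Set.Finite.of_finite_fibers (fun x : A => b • x) (ha.subset hmaps.image_subset) ?_
  rintro _ ⟨x, -, rfl⟩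
  refine (hb.image (fun y => x + y)).subset ?_
  rintro z ⟨-, hz⟩
  refine ⟨z - x, ?_, by simp⟩
  have hz : b • z = b • x := hz
  simp [smul_sub, hz]

/-- In a `p`-primary abelian group with finite `p`-torsion, the `m`-torsion is finite for every
positive `m`. -/
theorem finite_setOf_nsmul_eq_zero_of_primary {A : Type*} [AddCommGroup A] {p : ℕ}
    (hp : p.Prime) (horder : ∀ a : A, ∃ n : ℕ, p ^ n • a = 0)
    (hfin : {a : A | p • a = 0}.Finite) {m : ℕ} (hm : m ≠ 0) :
    {a : A | m • a = 0}.Finite := by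
  induction m using Nat.recOnMul with
  | zero => exact absurd rfl hm
  | one => simp
  | prime q hq =>
    rcases eq_or_ne q p with rfl | hqp
    · exact hfin
    · refine (Set.finite_singleton (0 : A)).subset fun a ha => ?_
      obtain ⟨n, hn⟩ := horder a
      have hcop : Nat.Coprime q (p ^ n) := ((Nat.coprime_primes hq hp).2 hqp).pow_right n
      have hdvd := Nat.dvd_gcd (addOrderOf_dvd_of_nsmul_eq_zero ha)
        (addOrderOf_dvd_of_nsmul_eq_zero hn)
      rw [hcop, Nat.dvd_one, AddMonoid.addOrderOf_eq_one_iff] at hdvd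
      exact hdvd
  | mul a b iha ihb =>
    exact finite_setOf_mul_nsmul_eq_zero (iha (left_ne_zero_of_mul hm))
      (ihb (right_ne_zero_of_mul hm))

/-- The image of a finite abelian group in a group of exponent dividing `m` is at most as large
as its `m`-torsion. -/
theorem card_range_le_card_ker_nsmul {F H : Type*} [AddCommGroup F] [AddCommGroup H] [Finite F]
    (f : F →+ H) {m : ℕ} (hexp : ∀ h : H, m • h = 0) :
    Nat.card f.range ≤ Nat.card (nsmulAddMonoidHom m : F →+ F).ker := by
  have hle : (nsmulAddMonoidHom m : F →+ F).range ≤ f.ker := by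
    rintro _ ⟨x, rfl⟩
    simp [AddMonoidHom.mem_ker, hexp]
  rw [← AddSubgroup.index_ker f, ← AddSubgroup.index_range]
  exact Nat.le_of_dvd (Nat.pos_of_ne_zero AddSubgroup.index_ne_zero_of_finite)
    (AddSubgroup.index_dvd_of_le hle)

/-- if `A` is a `p`-primary abelian group with finite `p`-torsion subgroup `A[p]`,
`f : A → H` is a surjective homomorphism of abelian groups, and `H` has finite exponent,
then `H` is finite. -/
theorem statement2 (p : ℕ) (hp : p.Prime) (A H : Type*) [AddCommGroup A] [AddCommGroup H]
    (horder : ∀ a : A, ∃ n : ℕ, p ^ n • a = 0)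
    (hfin : {a : A | p • a = 0}.Finite)
    (f : A →+ H) (hsurj : Function.Surjective f)
    (m : ℕ) (hm : 0 < m) (hexp : ∀ h : H, m • h = 0) :
    Finite H := by
  classical
  have htors : {a : A | m • a = 0}.Finite :=
    finite_setOf_nsmul_eq_zero_of_primary hp horder hfin hm.ne'
  by_contra hH
  rw [not_finite_iff_infinite] at hH
  obtain ⟨s, hs⟩ := Infinite.exists_subset_card_eq H ({a : A | m • a = 0}.ncard + 1)
  choose g hg using hsurj
  let F : AddSubgroup A := AddSubgroup.closure (s.image g : Finset A)
  have hF_fg : AddGroup.FG F := (AddGroup.fg_iff_addSubgroup_fg F).2 ⟨_, rfl⟩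
  have hF_torsion : IsAddTorsion F := by
    intro x
    obtain ⟨n, hn⟩ := horder x
    exact isOfFinAddOrder_iff_nsmul_eq_zero.2
      ⟨p ^ n, pow_pos hp.pos n, Subtype.ext (by simpa using hn)⟩
  have hF : Finite F := AddCommGroup.finite_of_fg_isAddTorsion F hF_torsion
  have hsub : (s : Set H) ⊆ (f.comp F.subtype).range := by
    intro h hh
    exact ⟨⟨g h, AddSubgroup.subset_closure (by simpa using ⟨h, hh, rfl⟩)⟩, hg h⟩
  have hrange : s.card ≤ Nat.card (f.comp F.subtype).range := by
    rw [← Set.ncard_coe_finset]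
    exact Set.ncard_le_ncard hsub (Set.finite_range (f.comp F.subtype))
  have hker : Nat.card (nsmulAddMonoidHom m : F →+ F).ker ≤ {a : A | m • a = 0}.ncard := by
    refine Set.ncard_le_ncard_of_injOn (s := ((nsmulAddMonoidHom m : F →+ F).ker : Set F))
      (fun x : F => (x : A)) ?_ Subtype.val_injective.injOn htors
    intro x hx
    simpa using congrArg (Subtype.val : F → A) (AddMonoidHom.mem_ker.1 hx)
  have := card_range_le_card_ker_nsmul (f.comp F.subtype) hexp
  omega
end

section
/- Let G be a group generated by a single element σ (that is, every element of G is an integer power of σ), and let M be a G-module (an abelian group with G-action by automorphisms) that is finitely generated as an abelian group. Then the first group cohomology H^1(G, M) is finitely generated as an abelian group. -/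
universe u

/-- A 1-cocycle on a group generated by `σ` is determined by its value at `σ`. -/
theorem cocycles₁_eval_generator_injective {k G : Type u} [CommRing k] [Group G] (σ : G)
    (hgen : ∀ g : G, g ∈ Subgroup.zpowers σ) (M : Rep.{u} k G) :
    Function.Injective
      ((LinearMap.proj σ : (G → M) →ₗ[k] M) ∘ₗ (groupCohomology.cocycles₁ M).subtype) := by
  rw [injective_iff_map_eq_zero]
  intro f hf
  have hσ : f σ = 0 := hf
  have hmul := (groupCohomology.mem_cocycles₁_iff f.1).1 f.2
  let K : Subgroup G :=
    { carrier := {g | f g = 0}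
      one_mem' := groupCohomology.cocycles₁_map_one f
      mul_mem' := fun {a b} (ha : f a = 0) (hb : f b = 0) =>
        (hmul a b).trans (by
          change M.ρ a (f b) + f a = 0
          rw [ha, hb, map_zero, add_zero])
      inv_mem' := fun {a} (ha : f a = 0) => by
        have h := groupCohomology.cocycles₁_map_inv f a
        rw [ha, neg_zero] at h
        have h' := congrArg (M.ρ a⁻¹) h
        rwa [map_zero, Representation.inv_self_apply] at h' }
  have hK : Subgroup.zpowers σ ≤ K := Subgroup.zpowers_le.2 hσ
  exact groupCohomology.cocycles₁_ext fun g => hK (hgen g)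

/-- Over a Noetherian ring, the first cohomology of a group generated by one element with
coefficients in a finite module is finite. -/
theorem finite_H1_of_generator {k G : Type u} [CommRing k] [IsNoetherianRing k] [Group G] (σ : G)
    (hgen : ∀ g : G, g ∈ Subgroup.zpowers σ) (M : Rep.{u} k G) [Module.Finite k M] :
    Module.Finite k (groupCohomology.H1 M) := by
  have : Module.Finite k (groupCohomology.cocycles₁ M) :=
    Module.Finite.of_injective _ (cocycles₁_eval_generator_injective σ hgen M)
  exact Module.Finite.of_surjective (groupCohomology.H1π M).hom
    ((ModuleCat.epi_iff_surjective _).1 inferInstance)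

/-- if `G` is a group generated by a single element `σ` and `M` is a `G`-module
(a representation of `G` over `ℤ`, i.e. an abelian group with `G`-action by automorphisms)
which is finitely generated as an abelian group, then the first group cohomology `H¹(G, M)`
is finitely generated as an abelian group. -/
theorem statement10 {G : Type} [Group G] (σ : G) (hgen : ∀ g : G, g ∈ Subgroup.zpowers σ)
    (M : Rep ℤ G) (hfg : Module.Finite ℤ M.V) :
    Module.Finite ℤ (groupCohomology.H1 M) := by
  have : @Module.Finite ℤ M _ _ M.hV2 := by
    convert hfg
    exact Subsingleton.elim _ _
  convert finite_H1_of_generator σ hgen M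
end
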